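/- Let G be a k-partite k-uniform hypergraph with N vertices, and suppose rank_ℝ(I_G) = N - (k-1) and rank_{GF(q)}(I_G) = N - (k-1) for every prime q with q ≤ k^{N/2}. Then G is globally rigid in ℂ^1, i.e., for every generic configuration p ∈ ℂ^N, any q ∈ ℂ^N with f_G^1(q) = f_G^1(p) is congruent to p. -/

import Mathlib

open Module

namespace Matrix

/-- A square matrix whose columns have squared Euclidean norm at most `c` has squared determinant
at most `c ^ card n`. -/
theorem det_sq_le_pow_of_sum_sq_le {n : Type*} [Fintype n] [DecidableEq n] (A : Matrix n n ℝ)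
    {c : ℝ} (h : ∀ j, ∑ i, A i j ^ 2 ≤ c) : A.det ^ 2 ≤ c ^ Fintype.card n := by
  rcases isEmpty_or_nonempty n with hn | hn
  · simp
  have hps := posSemidef_conjTranspose_mul_self A
  have hdet : A.det ^ 2 = ∏ i, hps.1.eigenvalues i := by
    have := hps.1.det_eq_prod_eigenvalues
    rw [det_mul, det_conjTranspose] at this
    simpa [sq] using this
  have htr : ∑ i, hps.1.eigenvalues i ≤ Fintype.card n * c := by
    have := hps.1.trace_eq_sum_eigenvalues
    simp only [RCLike.ofReal_real_eq_id, id] at this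
    rw [← this, trace]
    calc _ = ∑ j, ∑ i, A i j ^ 2 := by simp [mul_apply, sq]
      _ ≤ ∑ _j : n, c := Finset.sum_le_sum fun j _ => h j
      _ = _ := by simp
  have hcard : (0 : ℝ) < Fintype.card n := by exact_mod_cast Fintype.card_pos
  have hnn := fun i => hps.eigenvalues_nonneg i
  have amgm := Real.geom_mean_le_arith_mean Finset.univ (fun _ => 1) hps.1.eigenvalues
    (fun _ _ => zero_le_one) (by simpa using Fintype.card_pos) (fun i _ => hnn i)
  simp only [Real.rpow_one, Finset.sum_const, Finset.card_univ, nsmul_eq_mul, mul_one,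
    one_mul] at amgm
  have hle : (∏ i, hps.1.eigenvalues i) ^ ((Fintype.card n : ℝ)⁻¹) ≤ c :=
    amgm.trans (by rw [div_le_iff₀ hcard]; linarith)
  have hprod : 0 ≤ ∏ i, hps.1.eigenvalues i := Finset.prod_nonneg fun i _ => hnn i
  rw [hdet, ← Real.rpow_inv_natCast_pow hprod (Fintype.card_ne_zero (α := n))]
  exact pow_le_pow_left₀ (Real.rpow_nonneg hprod _) hle _

/-- Some `A.rank` rows of a matrix `A` over a field are linearly independent. -/
theorem exists_linearIndependent_row_submatrix {m n K : Type*} [Finite m] [Fintype n] [Field K]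
    (A : Matrix m n K) :
    ∃ r : Fin A.rank → m, LinearIndependent K (A.submatrix r id).row := by
  have h := Submodule.exists_fun_fin_finrank_span_eq K (Set.range A.row)
  rw [← rank_eq_finrank_span_row] at h
  obtain ⟨f, hf, -, hli⟩ := h
  choose r hr using hf
  refine ⟨r, ?_⟩
  rwa [show (A.submatrix r id).row = f from funext hr]

/-- A matrix over a field has a nonvanishing minor of size its rank. -/
theorem exists_submatrix_det_ne_zero {m n K : Type*} [Fintype m] [Fintype n] [Field K]
    (A : Matrix m n K) :
    ∃ (r : Fin A.rank → m) (c : Fin A.rank → n), (A.submatrix r c).det ≠ 0 := by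
  obtain ⟨r, hr⟩ := A.exists_linearIndependent_row_submatrix
  have hrank : (A.submatrix r id)ᵀ.rank = A.rank := by
    rw [rank_transpose, hr.rank_matrix, Fintype.card_fin]
  have h := (A.submatrix r id)ᵀ.exists_linearIndependent_row_submatrix
  rw [hrank] at h
  obtain ⟨c, hc⟩ := h
  refine ⟨r, c, ?_⟩
  rw [← isUnit_iff_ne_zero, ← isUnit_iff_isUnit_det, ← isUnit_transpose,
    ← linearIndependent_rows_iff_isUnit]
  exact hc

end Matrix

namespace Hypergraph

variable {V E ι : Type*} (R : Type*) [CommRing R]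

/-- The vertex-edge incidence matrix. -/
def incidence [DecidableEq V] (edge : E → Finset V) : Matrix V E R :=
  Matrix.of fun v e => if v ∈ edge e then 1 else 0

variable [Fintype V] [DecidableEq ι]

/-- The sums of the entries of a vector over the vertex classes. -/
def classSum (part : V → ι) : (V → R) →ₗ[R] (ι → R) where
  toFun x i := ∑ v with part v = i, x v
  map_add' x y := by ext i; simp [Finset.sum_add_distrib]
  map_smul' c x := by ext i; simp [Finset.mul_sum]

/-- The vectors whose sums over all vertex classes agree. -/
def balanced (part : V → ι) : Submodule R (V → R) where
  carrier := {x | ∀ i j, classSum R part x i = classSum R part x j}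
  add_mem' hx hy i j := by simp [hx i j, hy i j]
  zero_mem' i j := by simp
  smul_mem' c x hx i j := by simp [hx i j]

variable {R}

theorem mem_balanced {part : V → ι} {x : V → R} :
    x ∈ balanced R part ↔ ∀ i j, classSum R part x i = classSum R part x j := Iff.rfl

variable (R)

theorem classSum_apply (part : V → ι) (x : V → R) (i : ι) :
    classSum R part x i = ∑ v with part v = i, x v := rfl

theorem classSum_single [DecidableEq V] (part : V → ι) (v : V) (c : R) :
    classSum R part (Pi.single v c) = Pi.single (part v) c := by
  ext i
  rw [classSum_apply, Finset.sum_filter, Finset.sum_eq_single v]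
  · by_cases h : part v = i
    · subst h; simp
    · simp [h]
  · intro w _ hw
    simp [hw]
  · simp

theorem classSum_section [Fintype ι] [DecidableEq V] {part : V → ι} {s : ι → V}
    (hs : ∀ i, part (s i) = i) :
    classSum R part (∑ i, Pi.single (s i) 1) = 1 := by
  ext j
  simp [map_sum, classSum_single, hs, Finset.sum_pi_single]

theorem section_mem_balanced [Fintype ι] [DecidableEq V] {part : V → ι} {s : ι → V}
    (hs : ∀ i, part (s i) = i) :
    (∑ i, Pi.single (s i) 1) ∈ balanced R part := by
  simp [mem_balanced, classSum_section R hs]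

theorem single_sub_single_mem_balanced [DecidableEq V] {part : V → ι} {v w : V}
    (h : part v = part w) : (Pi.single v 1 - Pi.single w 1) ∈ balanced R part := by
  simp [mem_balanced, classSum_single, h]

theorem classSum_incidence_col [DecidableEq V] {part : V → ι} {edge : E → Finset V}
    (huniform : ∀ (e : E) (i : ι), ∃! v, v ∈ edge e ∧ part v = i) (e : E) :
    classSum R part ((incidence R edge).col e) = 1 := by
  ext i
  obtain ⟨v, ⟨hv, hvi⟩, huniq⟩ := huniform e i
  rw [classSum_apply, Finset.sum_eq_single v]
  · simp [incidence, hv]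
  · intro w hw hne
    have : w ∉ edge e := fun hwe => hne (huniq w ⟨hwe, (Finset.mem_filter.1 hw).2⟩)
    simp [incidence, this]
  · simp [hvi]

theorem span_col_le_balanced [DecidableEq V] {part : V → ι} {edge : E → Finset V}
    (huniform : ∀ (e : E) (i : ι), ∃! v, v ∈ edge e ∧ part v = i) :
    Submodule.span R (Set.range (incidence R edge).col) ≤ balanced R part := by
  rw [Submodule.span_le]
  rintro _ ⟨e, rfl⟩ i j
  simp [classSum_incidence_col R huniform]

theorem finrank_balanced_le (F : Type*) [Field F] [Fintype ι] {part : V → ι}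
    (hpart : Function.Surjective part) :
    finrank F (balanced F part) ≤ Fintype.card V - (Fintype.card ι - 1) := by
  classical
  obtain ⟨s, hs⟩ := hpart.hasRightInverse
  set u : V → F := ∑ i, Pi.single (s i) 1 with hu
  have hle : balanced F part ≤ LinearMap.ker (classSum F part) ⊔ Submodule.span F {u} := by
    intro x hx
    rcases isEmpty_or_nonempty ι with hι | ⟨⟨i₀⟩⟩
    · exact Submodule.mem_sup_left (Subsingleton.elim _ _)
    rw [← sub_add_cancel x (classSum F part x i₀ • u)]
    refine Submodule.add_mem_sup ?_ (Submodule.smul_mem _ _ (Submodule.mem_span_singleton_self u))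
    rw [LinearMap.mem_ker]
    ext j
    simp [hu, classSum_section F hs, hx j i₀]
  have hsurj : Function.Surjective (classSum F part) := by
    intro y
    refine ⟨∑ i, Pi.single (s i) (y i), ?_⟩
    ext j
    simp [map_sum, classSum_single, hs _, Finset.sum_pi_single]
  have hker := (classSum F part).finrank_range_add_finrank_ker
  rw [LinearMap.range_eq_top.2 hsurj, finrank_top, finrank_fintype_fun_eq_card,
    finrank_fintype_fun_eq_card] at hker
  have h1 := Submodule.finrank_mono hle
  have h2 := Submodule.finrank_add_le_finrank_add_finrank (LinearMap.ker (classSum F part))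
    (Submodule.span F {u})
  have h3 : finrank F (Submodule.span F {u}) ≤ 1 := by
    simpa using finrank_span_le_card (R := F) ({u} : Set (V → F))
  have h4 := Submodule.finrank_le (balanced F part)
  rw [finrank_fintype_fun_eq_card] at h4
  omega

theorem span_col_eq_balanced (F : Type*) [Field F] [Fintype ι] [Fintype E] [DecidableEq V]
    {part : V → ι} (hpart : Function.Surjective part) {edge : E → Finset V}
    (huniform : ∀ (e : E) (i : ι), ∃! v, v ∈ edge e ∧ part v = i)
    (hrank : Fintype.card V - (Fintype.card ι - 1) ≤ (incidence F edge).rank) :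
    Submodule.span F (Set.range (incidence F edge).col) = balanced F part := by
  refine Submodule.eq_of_le_of_finrank_le (span_col_le_balanced F huniform) ?_
  rw [← Matrix.rank_eq_finrank_span_cols]
  exact (finrank_balanced_le F hpart).trans hrank

theorem map_classSum {R S : Type*} [CommRing R] [CommRing S] (part : V → ι) (f : R →+* S)
    (x : V → R) (i : ι) : classSum S part (f ∘ x) i = f (classSum R part x i) := by
  simp [classSum_apply]

theorem balanced_le_span_col_sup [Fintype E] [DecidableEq V] (q : ℕ) (hq : q ≠ 0)
    {part : V → ι} {edge : E → Finset V}
    (huniform : ∀ (e : E) (i : ι), ∃! v, v ∈ edge e ∧ part v = i)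
    (h : Submodule.span (ZMod q) (Set.range (incidence (ZMod q) edge).col)
      = balanced (ZMod q) part) :
    balanced ℤ part ≤ Submodule.span ℤ (Set.range (incidence ℤ edge).col) ⊔
      Ideal.span {(q : ℤ)} • balanced ℤ part := by
  intro x hx
  have hx' : Int.castRingHom (ZMod q) ∘ x ∈ balanced (ZMod q) part := fun i j => by
    rw [map_classSum, map_classSum, hx i j]
  rw [← h, ← Matrix.range_mulVecLin] at hx'
  obtain ⟨c, hc⟩ := hx'
  choose d hd using fun e => ZMod.intCast_surjective (c e)
  have hmem : (incidence ℤ edge).mulVec d ∈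
      Submodule.span ℤ (Set.range (incidence ℤ edge).col) := by
    rw [← Matrix.range_mulVecLin]
    exact ⟨d, rfl⟩
  have hdvd : ∀ v, (q : ℤ) ∣ (x - (incidence ℤ edge).mulVec d) v := fun v => by
    rw [← ZMod.intCast_zmod_eq_zero_iff_dvd, Pi.sub_apply, Int.cast_sub, sub_eq_zero]
    have hv := congrFun hc v
    rw [Matrix.mulVecLin_apply] at hv
    simp only [Function.comp_apply, eq_intCast] at hv
    rw [← hv]
    simp [Matrix.mulVec, dotProduct, incidence, hd]
  choose y hy using hdvd
  have hxy : x - (incidence ℤ edge).mulVec d = (q : ℤ) • y := funext hy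
  have hyb : y ∈ balanced ℤ part := by
    intro i j
    have := (balanced ℤ part).sub_mem hx (span_col_le_balanced ℤ huniform hmem) i j
    rw [hxy] at this
    rw [map_smul, Pi.smul_apply, Pi.smul_apply] at this
    exact smul_right_injective ℤ (Int.natCast_ne_zero.2 hq) this
  rw [← add_sub_cancel ((incidence ℤ edge).mulVec d) x, hxy]
  exact Submodule.add_mem_sup hmem
    (Submodule.smul_mem_smul (Ideal.mem_span_singleton_self _) hyb)

end Hypergraph

theorem zpow_finsetSum {G α : Type*} [CommGroup G] (g : G) (t : Finset α) (f : α → ℤ) :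
    g ^ (∑ i ∈ t, f i) = ∏ i ∈ t, g ^ f i := by
  classical
  induction t using Finset.induction_on with
  | empty => simp
  | insert a t ha ih => rw [Finset.sum_insert ha, Finset.prod_insert ha, zpow_add, ih]

/-- If `P ≤ N + q P` for every prime `q`, with `P` finitely generated, then `P ≤ N`. -/
theorem Submodule.le_of_forall_prime_le_sup {M : Type*} [AddCommGroup M]
    {N P : Submodule ℤ M} (hP : P.FG)
    (h : ∀ q : ℕ, q.Prime → P ≤ N ⊔ Ideal.span {(q : ℤ)} • P) : P ≤ N := by
  have hall : ∀ n : ℕ, n ≠ 0 → ∀ x ∈ P, ∃ y ∈ P, x - (n : ℤ) • y ∈ N := by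
    intro n
    induction n using Nat.recOnMul with
    | zero => exact fun h => absurd rfl h
    | one => exact fun _ x hx => ⟨x, hx, by simp⟩
    | prime q hq =>
      intro _ x hx
      obtain ⟨z, hz, w, hw, rfl⟩ := Submodule.mem_sup.1 (h q hq hx)
      rw [Submodule.ideal_span_singleton_smul] at hw
      obtain ⟨y, hy, rfl⟩ := hw
      exact ⟨y, hy, by simpa using hz⟩
    | mul a b ha hb =>
      intro hab x hx
      obtain ⟨y, hy, hxy⟩ := ha (left_ne_zero_of_mul hab) x hx
      obtain ⟨z, hz, hyz⟩ := hb (right_ne_zero_of_mul hab) y hy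
      refine ⟨z, hz, ?_⟩
      convert N.add_mem hxy (N.smul_mem (a : ℤ) hyz) using 1
      rw [smul_sub, smul_smul]
      push_cast
      abel
  obtain ⟨r, hr, hrN⟩ := Submodule.exists_sub_one_mem_and_smul_le_of_fg_of_le_sup hP le_rfl
    (h 2 Nat.prime_two)
  have hr0 : r.natAbs ≠ 0 := by
    rw [Ideal.mem_span_singleton] at hr
    push_cast at hr
    omega
  intro x hx
  obtain ⟨y, hy, hxy⟩ := hall _ hr0 x hx
  have hry : r • y ∈ N := hrN (Submodule.smul_mem_pointwise_smul y r P hy)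
  have hry' : (r.natAbs : ℤ) • y ∈ N := by
    rcases Int.natAbs_eq r with h | h
    · rwa [← h]
    · rw [h, neg_smul] at hry
      exact N.neg_mem_iff.1 hry
  simpa using N.add_mem hxy hry'

namespace Hypergraph

variable {V E ι : Type*} [Fintype V] [Fintype E] [DecidableEq V] [Fintype ι] [DecidableEq ι]
  {part : V → ι} {edge : E → Finset V}

omit [Fintype E] in
theorem sum_sq_incidence_submatrix_le
    (huniform : ∀ (e : E) (i : ι), ∃! v, v ∈ edge e ∧ part v = i) {m n : Type*} [Fintype m]
    {r : m → V} (hr : Function.Injective r) (c : n → E) (j : n) :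
    ∑ i, (incidence ℝ edge).submatrix r c i j ^ 2 ≤ Fintype.card ι := by
  calc ∑ i, (incidence ℝ edge).submatrix r c i j ^ 2
      = ∑ i, (incidence ℝ edge) (r i) (c j) := by
        simp [incidence]
    _ = ∑ v ∈ Finset.univ.map ⟨r, hr⟩, (incidence ℝ edge) v (c j) := by simp
    _ ≤ ∑ v, (incidence ℝ edge) v (c j) :=
        Finset.sum_le_sum_of_subset_of_nonneg (Finset.subset_univ _) fun v _ _ => by
          by_cases h : v ∈ edge (c j) <;> simp [incidence, h]
    _ = ∑ i, classSum ℝ part ((incidence ℝ edge).col (c j)) i :=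
        (Finset.sum_fiberwise _ part _).symm
    _ = Fintype.card ι := by simp [classSum_incidence_col ℝ huniform]

/-- The rank of the incidence matrix does not drop modulo primes beyond the Hadamard bound. -/
theorem rank_incidence_real_le_rank_zmod
    (huniform : ∀ (e : E) (i : ι), ∃! v, v ∈ edge e ∧ part v = i) {q : ℕ} [Fact q.Prime]
    (hq : (Fintype.card ι : ℝ) ^ ((Fintype.card V : ℝ) / 2) < q) :
    (incidence ℝ edge).rank ≤ (incidence (ZMod q) edge).rank := by
  obtain ⟨r, c, hdet⟩ := (incidence ℝ edge).exists_submatrix_det_ne_zero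
  have hr : Function.Injective r := fun i j hij => by
    by_contra hne
    exact hdet (Matrix.det_zero_of_row_eq hne (by ext; simp [hij]))
  set D : ℤ := ((incidence ℤ edge).submatrix r c).det with hD
  have hcast : ∀ {S : Type} [CommRing S], (D : S) = ((incidence S edge).submatrix r c).det := by
    intro S _
    rw [hD, ← eq_intCast (Int.castRingHom S), RingHom.map_det]
    congr 1
    ext i j
    simp only [RingHom.mapMatrix_apply, Matrix.map_apply, Matrix.submatrix_apply]
    simp [incidence]
  have hbound : (D : ℝ) ^ 2 ≤ (Fintype.card ι : ℝ) ^ Fintype.card V := by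
    rw [hcast]
    refine (Matrix.det_sq_le_pow_of_sum_sq_le _
      (sum_sq_incidence_submatrix_le huniform hr c)).trans ?_
    rw [Fintype.card_fin]
    rcases isEmpty_or_nonempty ι with hι | hι
    · have := Function.isEmpty part
      have hrank := (incidence ℝ edge).rank_le_card_height
      rw [Fintype.card_eq_zero (α := V)] at hrank ⊢
      rw [Nat.le_zero.1 hrank]
    · exact pow_le_pow_right₀ (by exact_mod_cast Fintype.card_pos)
        (incidence ℝ edge).rank_le_card_height
  have hDq : |(D : ℝ)| < q := by
    refine lt_of_le_of_lt ?_ hq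
    refine abs_le_of_sq_le_sq (hbound.trans_eq ?_) (by positivity)
    rw [← Real.rpow_natCast, ← Real.rpow_natCast, ← Real.rpow_mul (by positivity)]
    congr 1
    push_cast
    ring
  have hD0 : D ≠ 0 := fun h => hdet (by rw [← hcast, h, Int.cast_zero])
  have hDZ : ((incidence (ZMod q) edge).submatrix r c).det ≠ 0 := by
    rw [← hcast, Ne, ZMod.intCast_zmod_eq_zero_iff_dvd]
    intro hdvd
    have hle := Int.le_of_dvd (abs_pos.2 hD0) ((dvd_abs _ _).2 hdvd)
    have : |D| < q := by exact_mod_cast hDq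
    exact absurd hle (not_le.2 this)
  have hle := (incidence (ZMod q) edge).rank_submatrix_le r c
  rwa [Matrix.rank_of_det_ne_zero hDZ, Fintype.card_fin] at hle

theorem balanced_le_span_col (hpart : Function.Surjective part)
    (huniform : ∀ (e : E) (i : ι), ∃! v, v ∈ edge e ∧ part v = i)
    (hrankR : (incidence ℝ edge).rank = Fintype.card V - (Fintype.card ι - 1))
    (hrankq : ∀ q : ℕ, q.Prime → (q : ℝ) ≤ (Fintype.card ι : ℝ) ^ ((Fintype.card V : ℝ) / 2) →
      (incidence (ZMod q) edge).rank = Fintype.card V - (Fintype.card ι - 1)) :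
    balanced ℤ part ≤ Submodule.span ℤ (Set.range (incidence ℤ edge).col) := by
  refine Submodule.le_of_forall_prime_le_sup (IsNoetherian.noetherian _) fun q hq => ?_
  have : Fact q.Prime := ⟨hq⟩
  refine balanced_le_span_col_sup q hq.ne_zero huniform
    (span_col_eq_balanced (ZMod q) hpart huniform ?_)
  rcases le_or_gt (q : ℝ) ((Fintype.card ι : ℝ) ^ ((Fintype.card V : ℝ) / 2)) with h | h
  · exact (hrankq q hq h).ge
  · exact hrankR.ge.trans (rank_incidence_real_le_rank_zmod huniform h)

omit [Fintype E] in
/-- Multiplicative weights with trivial edge products are trivial on every integer combination of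
edges. -/
theorem prod_zpow_eq_one_of_mem_span_col {G : Type*} [CommGroup G] {r : V → G}
    (hr : ∀ e, ∏ v ∈ edge e, r v = 1) {x : V → ℤ}
    (hx : x ∈ Submodule.span ℤ (Set.range (incidence ℤ edge).col)) : ∏ v, r v ^ x v = 1 := by
  induction hx using Submodule.span_induction with
  | mem x h =>
    obtain ⟨e, rfl⟩ := h
    rw [← hr e]
    simp [incidence, Finset.prod_ite_mem]
  | zero => simp
  | add x y _ _ hx hy => simp [zpow_add, Finset.prod_mul_distrib, hx, hy]
  | smul c x _ hx => simp [mul_comm c, zpow_mul, Finset.prod_zpow, hx]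

theorem exists_mem_edge (hpart : Function.Surjective part)
    (h : balanced ℤ part ≤ Submodule.span ℤ (Set.range (incidence ℤ edge).col)) (v : V) :
    ∃ e, v ∈ edge e := by
  by_contra! hv
  obtain ⟨s, hs⟩ := hpart.hasRightInverse
  have hs' : ∀ i, part (Function.update s (part v) v i) = i := by
    intro i
    by_cases hi : i = part v
    · subst hi; simp
    · simp [hi, hs i]
  have hmem := h (section_mem_balanced ℤ hs')
  rw [← Matrix.range_mulVecLin] at hmem
  obtain ⟨c, hc⟩ := hmem
  have hcv := congrFun hc v
  have hone : ∀ i, (Pi.single (Function.update s (part v) v i) 1 : V → ℤ) v =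
      if i = part v then 1 else 0 := by
    intro i
    by_cases hi : i = part v
    · subst hi; simp
    · have hne : v ≠ Function.update s (part v) v i :=
        fun h' => hi ((hs' i).symm.trans (h' ▸ rfl))
      rw [Pi.single_eq_of_ne hne, if_neg hi]
  rw [Finset.sum_apply, Finset.sum_congr rfl fun i _ => hone i] at hcv
  simp [Matrix.mulVec, dotProduct, incidence, hv] at hcv

omit [Fintype E] in
theorem exists_scalars_of_prod_eq_one {G : Type*} [CommGroup G] (hpart : Function.Surjective part)
    (h : balanced ℤ part ≤ Submodule.span ℤ (Set.range (incidence ℤ edge).col)) {r : V → G}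
    (hr : ∀ e, ∏ v ∈ edge e, r v = 1) :
    ∃ a : ι → G, ∏ i, a i = 1 ∧ ∀ v, r v = a (part v) := by
  obtain ⟨s, hs⟩ := hpart.hasRightInverse
  have key := fun x hx => prod_zpow_eq_one_of_mem_span_col hr (h (x := x) hx)
  have hsingle : ∀ w, ∏ v, r v ^ (Pi.single w 1 : V → ℤ) v = r w := fun w => by
    simp [Pi.single_apply]
  refine ⟨fun i => r (s i), ?_, fun v => ?_⟩
  · have := key _ (section_mem_balanced ℤ hs)
    simp only [Finset.sum_apply, zpow_finsetSum] at this
    rw [Finset.prod_comm] at this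
    simpa only [hsingle] using this
  · have := key _ (single_sub_single_mem_balanced ℤ (hs (part v)).symm)
    simp only [Pi.sub_apply, zpow_sub, Finset.prod_mul_distrib, Finset.prod_inv_distrib,
      hsingle] at this
    exact mul_inv_eq_one.1 this

end Hypergraph

open Hypergraph

/-- If the incidence matrix of a k-partite k-uniform hypergraph G on N
vertices has rank N-(k-1) over ℝ and over GF(q) for every prime q ≤ k^{N/2}, then G is
globally rigid in ℂ^1: for every generic p ∈ ℂ^N, any q with f_G^1(q) = f_G^1(p) is
congruent to p. -/
theorem stmt_6 {k : ℕ} (V E : Type*) [Fintype V] [Fintype E] [DecidableEq V]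
    (part : V → Fin k) (hpart : Function.Surjective part)
    (edge : E → Finset V)
    (huniform : ∀ (e : E) (i : Fin k), ∃! v, v ∈ edge e ∧ part v = i)
    (hrankR : (Matrix.of fun (v : V) (e : E) => if v ∈ edge e then (1 : ℝ) else 0).rank
      = Fintype.card V - (k - 1))
    (hrankq : ∀ q : ℕ, q.Prime → (q : ℝ) ≤ (k : ℝ) ^ ((Fintype.card V : ℝ) / 2) →
      (Matrix.of fun (v : V) (e : E) => if v ∈ edge e then (1 : ZMod q) else 0).rank
        = Fintype.card V - (k - 1)) :
    ∀ p : V → ℂ, AlgebraicIndependent ℚ p →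
      ∀ q : V → ℂ, (∀ e, ∏ v ∈ edge e, q v = ∏ v ∈ edge e, p v) →
        ∃ a : Fin k → ℂ, (∏ i, a i) = 1 ∧ ∀ v, q v = a (part v) * p v := by
  intro p hp q hpq
  have hspan : balanced ℤ part ≤ Submodule.span ℤ (Set.range (incidence ℤ edge).col) := by
    refine balanced_le_span_col hpart huniform ?_ ?_ <;> rw [Fintype.card_fin]
    exacts [hrankR, hrankq]
  have hp0 : ∀ v, p v ≠ 0 := fun v => hp.ne_zero v
  have hq0 : ∀ v, q v ≠ 0 := fun v => by
    obtain ⟨e, he⟩ := exists_mem_edge hpart hspan v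
    have : ∏ w ∈ edge e, q w ≠ 0 := hpq e ▸ Finset.prod_ne_zero_iff.2 fun w _ => hp0 w
    exact Finset.prod_ne_zero_iff.1 this v he
  obtain ⟨a, ha, hav⟩ := exists_scalars_of_prod_eq_one hpart hspan
    (r := fun v => Units.mk0 (q v) (hq0 v) / Units.mk0 (p v) (hp0 v)) fun e => by
      ext
      simp [Finset.prod_div_distrib, hpq e, div_self (Finset.prod_ne_zero_iff.2 fun w _ => hp0 w)]
  refine ⟨fun i => a i, by simpa using congrArg Units.val ha, fun v => ?_⟩
  simp [← hav v, hp0 v]
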